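/- If K is a triangulation of a compact n-manifold M with boundary, then H^{n-i}(M) ≅ H_i(M, ∂M) for all i (Lefschetz duality), as derived from the collapse of the cohomeology spectral sequence: the complex (E_1^{*,n}(K), Δ_1) is isomorphic to the relative chain complex (C_*(K, ∂K), d). -/

import Mathlib

open Finset

/-- A finite abstract simplicial complex with vertices in `ℕ`. -/
structure SC where
  faces : Finset (Finset ℕ)
  down_closed : ∀ ⦃s t : Finset ℕ⦄, s ∈ faces → t ⊆ s → t ∈ faces

namespace SC

/-- The vertex set of a simplicial complex. -/
def verts (K : SC) : Finset ℕ := K.faces.sup id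

/-- The dimension of a simplicial complex (dimension of `{∅}` is `-1`). -/
def dim (K : SC) : ℤ := ((K.faces.sup Finset.card : ℕ) : ℤ) - 1

/-- The link of a simplex. -/
def link (K : SC) (σ : Finset ℕ) : SC where
  faces := K.faces.filter fun t => σ ∪ t ∈ K.faces ∧ Disjoint σ t
  down_closed := by
    intro s t hs hts
    simp only [mem_filter] at hs ⊢
    refine ⟨K.down_closed hs.1 hts, K.down_closed hs.2.1 (union_subset_union_right hts),
      hs.2.2.mono_right ?_⟩
    exact_mod_cast hts

/-- `K₁` is a subcomplex of `K`. -/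
def IsSub (K₁ K : SC) : Prop := K₁.faces ⊆ K.faces

/-- Union of two simplicial complexes. -/
def union (K L : SC) : SC where
  faces := K.faces ∪ L.faces
  down_closed := by
    intro s t hs hts
    rcases mem_union.mp hs with h | h
    · exact mem_union_left _ (K.down_closed h hts)
    · exact mem_union_right _ (L.down_closed h hts)

/-- Intersection of two simplicial complexes. -/
def inter (K L : SC) : SC where
  faces := K.faces ∩ L.faces
  down_closed := by
    intro s t hs hts
    rw [mem_inter] at hs ⊢
    exact ⟨K.down_closed hs.1 hts, L.down_closed hs.2 hts⟩

/-- The join of two simplicial complexes. -/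
def join (K L : SC) : SC where
  faces := (K.faces ×ˢ L.faces).image fun x => x.1 ∪ x.2
  down_closed := by
    intro s t hs hts
    simp only [mem_image, mem_product] at hs ⊢
    obtain ⟨⟨a, b⟩, ⟨ha, hb⟩, rfl⟩ := hs
    refine ⟨⟨t ∩ a, t \ a⟩, ⟨K.down_closed ha inter_subset_right,
      L.down_closed hb fun x hx => ?_⟩, ?_⟩
    · rcases mem_union.mp (hts (mem_sdiff.mp hx).1) with h | h
      · exact absurd h (mem_sdiff.mp hx).2
      · exact h
    · ext x
      simp only [mem_union, mem_inter, mem_sdiff]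
      constructor
      · rintro (⟨h, _⟩ | ⟨h, _⟩) <;> exact h
      · intro hx
        by_cases hxa : x ∈ a
        · exact Or.inl ⟨hx, hxa⟩
        · exact Or.inr ⟨hx, hxa⟩

end SC
namespace SC
open Finset

/-- The sign of a vertex `v` in a simplex, given by its position in the canonical ordering. -/
def psgn (v : ℕ) (s : Finset ℕ) : ℤ := (-1) ^ (s.filter fun u => u < v).card

variable (G : Type) [AddCommGroup G]

/-- The submodule of functions supported on a given set of indices. -/
def suppM {α : Type} (P : α → Prop) : Submodule ℤ (α → G) where
  carrier := {c | ∀ x, c x ≠ 0 → P x}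
  add_mem' := by
    intro a b ha hb x hx
    by_cases h : a x = 0
    · exact hb x (by simpa [h] using hx)
    · exact ha x h
  zero_mem' := fun x hx => absurd rfl hx
  smul_mem' := by
    intro z a ha x hx
    exact ha x fun h => hx (by simp [h])

end SC
namespace SC
open Finset

variable (G : Type) [AddCommGroup G]

/-- The unreduced simplicial coboundary (as a map on coefficient functions). -/
def cobF (K : SC) (c : Finset ℕ → G) : Finset ℕ → G := fun ρ =>
  if ρ ∈ K.faces then
    ∑ w ∈ ρ, if ρ.erase w = ∅ then 0 else psgn w ρ • c (ρ.erase w)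
  else 0

/-- The reduced simplicial coboundary. -/
def cobRF (K : SC) (c : Finset ℕ → G) : Finset ℕ → G := fun ρ =>
  if ρ ∈ K.faces then ∑ w ∈ ρ, psgn w ρ • c (ρ.erase w) else 0

/-- The unreduced simplicial coboundary as a linear map. -/
def cobL (K : SC) : (Finset ℕ → G) →ₗ[ℤ] (Finset ℕ → G) where
  toFun := cobF G K
  map_add' := by
    intro a b
    funext ρ
    simp only [cobF, Pi.add_apply]
    split_ifs with h
    · rw [← Finset.sum_add_distrib]
      refine Finset.sum_congr rfl fun w _ => ?_
      split_ifs with h2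
      · simp
      · simp [smul_add]
    · simp
  map_smul' := by
    intro z a
    funext ρ
    simp only [cobF, Pi.smul_apply, RingHom.id_apply]
    split_ifs with h
    · rw [Finset.smul_sum]
      refine Finset.sum_congr rfl fun w _ => ?_
      split_ifs with h2
      · simp
      · rw [smul_smul, smul_smul, mul_comm]
    · simp

/-- The reduced simplicial coboundary as a linear map. -/
def cobRL (K : SC) : (Finset ℕ → G) →ₗ[ℤ] (Finset ℕ → G) where
  toFun := cobRF G K
  map_add' := by
    intro a b
    funext ρ
    simp only [cobRF, Pi.add_apply]
    split_ifs with h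
    · rw [← Finset.sum_add_distrib]
      exact Finset.sum_congr rfl fun w _ => smul_add _ _ _
    · simp
  map_smul' := by
    intro z a
    funext ρ
    simp only [cobRF, Pi.smul_apply, RingHom.id_apply]
    split_ifs with h
    · rw [Finset.smul_sum]
      refine Finset.sum_congr rfl fun w _ => ?_
      rw [smul_smul, smul_smul, mul_comm]
    · simp

/-- Degree-`q` unreduced simplicial cochains of `K` with coefficients in `G`. -/
def Cgr (K : SC) (q : ℤ) : Submodule ℤ (Finset ℕ → G) :=
  suppM G fun s => s ∈ K.faces ∧ s ≠ ∅ ∧ (s.card : ℤ) = q + 1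

/-- Degree-`q` reduced simplicial cochains (the empty simplex sits in degree `-1`). -/
def CgrR (K : SC) (q : ℤ) : Submodule ℤ (Finset ℕ → G) :=
  suppM G fun s => s ∈ K.faces ∧ (s.card : ℤ) = q + 1

/-- The degree-`q` simplicial cohomology of `K` with coefficients in `G`. -/
abbrev coh (K : SC) (q : ℤ) :=
  ↥(Cgr G K q ⊓ LinearMap.ker (cobL G K)) ⧸
    Submodule.comap (Cgr G K q ⊓ LinearMap.ker (cobL G K)).subtype
      (Submodule.map (cobL G K) (Cgr G K (q - 1)))

/-- The degree-`q` reduced simplicial cohomology of `K` with coefficients in `G`. -/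
abbrev cohR (K : SC) (q : ℤ) :=
  ↥(CgrR G K q ⊓ LinearMap.ker (cobRL G K)) ⧸
    Submodule.comap (CgrR G K q ⊓ LinearMap.ker (cobRL G K)).subtype
      (Submodule.map (cobRL G K) (CgrR G K (q - 1)))

end SC
namespace SC
open Finset

/-- Pairs of simplices, indexing the double complex `N^{*,*}`. -/
abbrev Pr := Finset ℕ × Finset ℕ

variable (G : Type) [AddCommGroup G]

/-- The `(p,q)`-graded piece of the double complex `N^{*,*}(K)` spanned by `σ ⊗ τ`, `σ ⊆ τ`. -/
def Ngr (K : SC) (p q : ℤ) : Submodule ℤ (Pr → G) :=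
  suppM G fun x => x.1 ⊆ x.2 ∧ x.2 ∈ K.faces ∧ x.1 ≠ ∅ ∧
    (x.1.card : ℤ) = p + 1 ∧ (x.2.card : ℤ) = q + 1

/-- The `(p,q)`-graded piece of the reduced double complex `Ñ^{*,*}(K)`. -/
def NgrR (K : SC) (p q : ℤ) : Submodule ℤ (Pr → G) :=
  suppM G fun x => x.1 ⊆ x.2 ∧ x.2 ∈ K.faces ∧
    (x.1.card : ℤ) = p + 1 ∧ (x.2.card : ℤ) = q + 1

/-- The vertical differential `σ ⊗ τ ↦ (-1)^{|σ|} σ ⊗ δτ` (unreduced). -/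
def dvF (K : SC) (c : Pr → G) : Pr → G := fun x =>
  if x.2 ∈ K.faces ∧ x.1 ⊆ x.2 ∧ x.1 ≠ ∅ then
    ((-1 : ℤ) ^ x.1.card) •
      ∑ w ∈ x.2, if x.1 ⊆ x.2.erase w then psgn w x.2 • c (x.1, x.2.erase w) else 0
  else 0

/-- The horizontal differential `σ ⊗ τ ↦ dσ ⊗ τ` (unreduced). -/
def dhF (K : SC) (c : Pr → G) : Pr → G := fun x =>
  if x.2 ∈ K.faces ∧ x.1 ⊆ x.2 ∧ x.1 ≠ ∅ then
    ∑ v ∈ x.2 \ x.1, psgn v (insert v x.1) • c (insert v x.1, x.2)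
  else 0

/-- The vertical differential (reduced). -/
def dvRF (K : SC) (c : Pr → G) : Pr → G := fun x =>
  if x.2 ∈ K.faces ∧ x.1 ⊆ x.2 then
    ((-1 : ℤ) ^ x.1.card) •
      ∑ w ∈ x.2, if x.1 ⊆ x.2.erase w then psgn w x.2 • c (x.1, x.2.erase w) else 0
  else 0

/-- The horizontal differential (reduced). -/
def dhRF (K : SC) (c : Pr → G) : Pr → G := fun x =>
  if x.2 ∈ K.faces ∧ x.1 ⊆ x.2 then
    ∑ v ∈ x.2 \ x.1, psgn v (insert v x.1) • c (insert v x.1, x.2)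
  else 0

/-- The vertical differential as a linear map (unreduced). -/
def dvL (K : SC) : (Pr → G) →ₗ[ℤ] (Pr → G) where
  toFun := dvF G K
  map_add' := by
    intro a b
    funext x
    simp only [dvF, Pi.add_apply]
    split_ifs with h
    · rw [← smul_add, ← Finset.sum_add_distrib]
      congr 1
      refine Finset.sum_congr rfl fun w _ => ?_
      split_ifs with h2
      · simp [smul_add]
      · simp
    · simp
  map_smul' := by
    intro z a
    funext x
    simp only [dvF, Pi.smul_apply, RingHom.id_apply]
    split_ifs with h
    · rw [smul_comm z]
      congr 1
      rw [Finset.smul_sum]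
      refine Finset.sum_congr rfl fun w _ => ?_
      split_ifs with h2
      · rw [smul_smul, smul_smul, mul_comm]
      · simp
    · simp

/-- The horizontal differential as a linear map (unreduced). -/
def dhL (K : SC) : (Pr → G) →ₗ[ℤ] (Pr → G) where
  toFun := dhF G K
  map_add' := by
    intro a b
    funext x
    simp only [dhF, Pi.add_apply]
    split_ifs with h
    · rw [← Finset.sum_add_distrib]
      exact Finset.sum_congr rfl fun v _ => smul_add _ _ _
    · simp
  map_smul' := by
    intro z a
    funext x
    simp only [dhF, Pi.smul_apply, RingHom.id_apply]
    split_ifs with h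
    · rw [Finset.smul_sum]
      refine Finset.sum_congr rfl fun v _ => ?_
      rw [smul_smul, smul_smul, mul_comm]
    · simp

/-- The vertical differential as a linear map (reduced). -/
def dvRL (K : SC) : (Pr → G) →ₗ[ℤ] (Pr → G) where
  toFun := dvRF G K
  map_add' := by
    intro a b
    funext x
    simp only [dvRF, Pi.add_apply]
    split_ifs with h
    · rw [← smul_add, ← Finset.sum_add_distrib]
      congr 1
      refine Finset.sum_congr rfl fun w _ => ?_
      split_ifs with h2
      · simp [smul_add]
      · simp
    · simp
  map_smul' := by
    intro z a
    funext x
    simp only [dvRF, Pi.smul_apply, RingHom.id_apply]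
    split_ifs with h
    · rw [smul_comm z]
      congr 1
      rw [Finset.smul_sum]
      refine Finset.sum_congr rfl fun w _ => ?_
      split_ifs with h2
      · rw [smul_smul, smul_smul, mul_comm]
      · simp
    · simp

/-- The horizontal differential as a linear map (reduced). -/
def dhRL (K : SC) : (Pr → G) →ₗ[ℤ] (Pr → G) where
  toFun := dhRF G K
  map_add' := by
    intro a b
    funext x
    simp only [dhRF, Pi.add_apply]
    split_ifs with h
    · rw [← Finset.sum_add_distrib]
      exact Finset.sum_congr rfl fun v _ => smul_add _ _ _
    · simp
  map_smul' := by
    intro z a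
    funext x
    simp only [dhRF, Pi.smul_apply, RingHom.id_apply]
    split_ifs with h
    · rw [Finset.smul_sum]
      refine Finset.sum_congr rfl fun v _ => ?_
      rw [smul_smul, smul_smul, mul_comm]
    · simp

/-- The total differential `Δ(σ⊗τ) = dσ⊗τ + (-1)^{|σ|}σ⊗δτ` (unreduced). -/
def dL (K : SC) : (Pr → G) →ₗ[ℤ] (Pr → G) := dhL G K + dvL G K

/-- The total differential (reduced). -/
def dRL (K : SC) : (Pr → G) →ₗ[ℤ] (Pr → G) := dhRL G K + dvRL G K

/-- Cocycles for the `E₁`-page: `ker Δ_v` in bidegree `(p,q)`. -/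
def Z1 (K : SC) (p q : ℤ) : Submodule ℤ (Pr → G) :=
  Ngr G K p q ⊓ LinearMap.ker (dvL G K)

/-- Coboundaries for the `E₁`-page. -/
def B1 (K : SC) (p q : ℤ) : Submodule ℤ (Pr → G) :=
  Submodule.map (dvL G K) (Ngr G K p (q - 1)) ⊓ Ngr G K p q

/-- The `E₁`-page of the cohomeology spectral sequence in bidegree `(p,q)`. -/
abbrev E1 (K : SC) (p q : ℤ) :=
  ↥(Z1 G K p q) ⧸ Submodule.comap (Z1 G K p q).subtype (B1 G K p q)

/-- Reduced `E₁`-cocycles. -/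
def Z1R (K : SC) (p q : ℤ) : Submodule ℤ (Pr → G) :=
  NgrR G K p q ⊓ LinearMap.ker (dvRL G K)

/-- Reduced `E₁`-coboundaries. -/
def B1R (K : SC) (p q : ℤ) : Submodule ℤ (Pr → G) :=
  Submodule.map (dvRL G K) (NgrR G K p (q - 1)) ⊓ NgrR G K p q

/-- The `E₁`-page of the reduced cohomeology spectral sequence. -/
abbrev E1R (K : SC) (p q : ℤ) :=
  ↥(Z1R G K p q) ⧸ Submodule.comap (Z1R G K p q).subtype (B1R G K p q)

/-- `E₂`-cocycles: vertical cocycles whose horizontal differential is a vertical coboundary. -/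
def Z2 (K : SC) (p q : ℤ) : Submodule ℤ (Pr → G) :=
  Ngr G K p q ⊓ LinearMap.ker (dvL G K) ⊓
    Submodule.comap (dhL G K) (Submodule.map (dvL G K) (Ngr G K (p - 1) (q - 1)))

/-- `E₂`-coboundaries. -/
def B2 (K : SC) (p q : ℤ) : Submodule ℤ (Pr → G) :=
  (Submodule.map (dvL G K) (Ngr G K p (q - 1)) ⊔
    Submodule.map (dhL G K) (Ngr G K (p + 1) q ⊓ LinearMap.ker (dvL G K))) ⊓ Ngr G K p q

/-- The cohomeology group `𝓗^{p,q}(K; G)`: the `E₂`-page of the cohomeology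
spectral sequence in bidegree `(p,q)`. -/
abbrev HH (K : SC) (p q : ℤ) :=
  ↥(Z2 G K p q) ⧸ Submodule.comap (Z2 G K p q).subtype (B2 G K p q)

/-- Reduced `E₂`-cocycles. -/
def Z2R (K : SC) (p q : ℤ) : Submodule ℤ (Pr → G) :=
  NgrR G K p q ⊓ LinearMap.ker (dvRL G K) ⊓
    Submodule.comap (dhRL G K) (Submodule.map (dvRL G K) (NgrR G K (p - 1) (q - 1)))

/-- Reduced `E₂`-coboundaries. -/
def B2R (K : SC) (p q : ℤ) : Submodule ℤ (Pr → G) :=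
  (Submodule.map (dvRL G K) (NgrR G K p (q - 1)) ⊔
    Submodule.map (dhRL G K) (NgrR G K (p + 1) q ⊓ LinearMap.ker (dvRL G K))) ⊓ NgrR G K p q

/-- The reduced cohomeology group `𝓗̃^{p,q}(K; G)`. -/
abbrev HHR (K : SC) (p q : ℤ) :=
  ↥(Z2R G K p q) ⧸ Submodule.comap (Z2R G K p q).subtype (B2R G K p q)

/-- Total-degree-`n` part of the total complex of `N^{*,*}(K)`. -/
def Tgr (K : SC) (n : ℤ) : Submodule ℤ (Pr → G) :=
  suppM G fun x => x.1 ⊆ x.2 ∧ x.2 ∈ K.faces ∧ x.1 ≠ ∅ ∧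
    (x.2.card : ℤ) - (x.1.card : ℤ) = n

/-- Total-degree-`n` part of the total complex of `Ñ^{*,*}(K)`. -/
def TgrR (K : SC) (n : ℤ) : Submodule ℤ (Pr → G) :=
  suppM G fun x => x.1 ⊆ x.2 ∧ x.2 ∈ K.faces ∧
    (x.2.card : ℤ) - (x.1.card : ℤ) = n

/-- The degree-`n` cohomology of the total complex of `N^{*,*}(K)`. -/
abbrev TotH (K : SC) (n : ℤ) :=
  ↥(Tgr G K n ⊓ LinearMap.ker (dL G K)) ⧸
    Submodule.comap (Tgr G K n ⊓ LinearMap.ker (dL G K)).subtype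
      (Submodule.map (dL G K) (Tgr G K (n - 1)) ⊓ Tgr G K n)

/-- The degree-`n` cohomology of the total complex of `Ñ^{*,*}(K)`. -/
abbrev TotHR (K : SC) (n : ℤ) :=
  ↥(TgrR G K n ⊓ LinearMap.ker (dRL G K)) ⧸
    Submodule.comap (TgrR G K n ⊓ LinearMap.ker (dRL G K)).subtype
      (Submodule.map (dRL G K) (TgrR G K (n - 1)) ⊓ TgrR G K n)

/-- The filtration `F^p` of the total complex by first degree. -/
def Fil (p : ℤ) : Submodule ℤ (Pr → G) :=
  suppM G fun x => (x.1.card : ℤ) ≤ p + 1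

/-- The `E_∞`-term of the cohomeology spectral sequence in bidegree `(p,p)`:
the `p`-th graded piece of the filtration induced on `H^0` of the total complex. -/
abbrev Einf0 (K : SC) (p : ℤ) :=
  ↥(Tgr ℤ K 0 ⊓ LinearMap.ker (dL ℤ K) ⊓ Fil ℤ p) ⧸
    Submodule.comap (Tgr ℤ K 0 ⊓ LinearMap.ker (dL ℤ K) ⊓ Fil ℤ p).subtype
      ((Tgr ℤ K 0 ⊓ LinearMap.ker (dL ℤ K) ⊓ Fil ℤ (p - 1)) ⊔
        (Submodule.map (dL ℤ K) (Tgr ℤ K (-1)) ⊓ Tgr ℤ K 0 ⊓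
          LinearMap.ker (dL ℤ K) ⊓ Fil ℤ p))

end SC
namespace SC
open Finset

/-- The relative simplicial chain complex `C_*(K, B)`: the boundary computed in
`K` and then projected off the faces of `B`. -/
def bdRelF (K B : SC) (c : Finset ℕ → ℤ) : Finset ℕ → ℤ := fun τ =>
  if τ ∈ K.faces ∧ τ ∉ B.faces ∧ τ ≠ ∅ then
    ∑ v ∈ K.verts \ τ, if insert v τ ∈ K.faces then psgn v (insert v τ) * c (insert v τ) else 0
  else 0

/-- The relative boundary as a linear map. -/
def bdRelL (K B : SC) : (Finset ℕ → ℤ) →ₗ[ℤ] (Finset ℕ → ℤ) where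
  toFun := bdRelF K B
  map_add' := by
    intro a b
    funext τ
    simp only [bdRelF, Pi.add_apply]
    split_ifs with h
    · rw [← Finset.sum_add_distrib]
      refine Finset.sum_congr rfl fun v _ => ?_
      split_ifs with h2 <;> ring
    · simp
  map_smul' := by
    intro z a
    funext τ
    simp only [bdRelF, Pi.smul_apply, RingHom.id_apply, smul_eq_mul]
    split_ifs with h
    · rw [Finset.mul_sum]
      refine Finset.sum_congr rfl fun v _ => ?_
      split_ifs with h2 <;> ring
    · simp

/-- Degree-`i` relative chains of `(K, B)`. -/
def RelC (K B : SC) (i : ℤ) : Submodule ℤ (Finset ℕ → ℤ) :=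
  suppM ℤ fun s => s ∈ K.faces ∧ s ∉ B.faces ∧ s ≠ ∅ ∧ (s.card : ℤ) = i + 1

/-- The degree-`i` relative simplicial homology `H_i(K, B)`. -/
abbrev Hrel (K B : SC) (i : ℤ) :=
  ↥(RelC K B i ⊓ LinearMap.ker (bdRelL K B)) ⧸
    Submodule.comap (RelC K B i ⊓ LinearMap.ker (bdRelL K B)).subtype
      (Submodule.map (bdRelL K B) (RelC K B (i + 1)) ⊓ RelC K B i)

end SC
namespace SC

theorem psgn_mul_self (v : ℕ) (s : Finset ℕ) : psgn v s * psgn v s = 1 := by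
  rw [psgn, ← mul_pow]; simp

theorem psgn_erase_of_lt {u v : ℕ} {s : Finset ℕ} (hu : u ∈ s) (h : u < v) :
    psgn v (s.erase u) = -psgn v s := by
  have hmem : u ∈ s.filter fun x => x < v := by simp [hu, h]
  rw [psgn, psgn, filter_erase, ← card_erase_add_one hmem, pow_succ]
  ring

theorem psgn_erase_of_le {u v : ℕ} (s : Finset ℕ) (h : v ≤ u) :
    psgn v (s.erase u) = psgn v s := by
  rw [psgn, psgn, filter_erase, erase_eq_of_notMem]
  simp [h]

theorem psgn_swap {u v : ℕ} {s : Finset ℕ} (hu : u ∈ s) (hv : v ∈ s) (h : u ≠ v) :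
    psgn u s * psgn v (s.erase u) = -(psgn v s * psgn u (s.erase v)) := by
  rcases lt_or_gt_of_ne h with h | h
  · rw [psgn_erase_of_lt hu h, psgn_erase_of_le s h.le]; ring
  · rw [psgn_erase_of_lt hv h, psgn_erase_of_le s h.le]; ring

theorem sum_erase_antisymm (S : Finset ℕ) (f : ℕ → ℕ → ℤ)
    (h : ∀ u ∈ S, ∀ v ∈ S, u ≠ v → f u v = -f v u) :
    ∑ u ∈ S, ∑ v ∈ S.erase u, f u v = 0 := by
  have key : ∀ g : ℕ → ℕ → ℤ,
      ∑ u ∈ S, ∑ v ∈ S.erase u, g u v = ∑ u ∈ S, ∑ v ∈ S, if u = v then 0 else g u v := by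
    intro g
    refine sum_congr rfl fun u _ => ?_
    rw [← filter_ne, sum_filter]
    refine sum_congr rfl fun v _ => ?_
    split_ifs <;> simp_all
  have h1 : ∑ u ∈ S, ∑ v ∈ S.erase u, f u v = -∑ u ∈ S, ∑ v ∈ S.erase u, f u v := by
    conv_lhs => rw [key, sum_comm]
    rw [key, ← sum_neg_distrib]
    refine sum_congr rfl fun u hu => ?_
    rw [← sum_neg_distrib]
    refine sum_congr rfl fun v hv => ?_
    by_cases huv : u = v
    · simp [huv]
    · rw [if_neg (Ne.symm huv), if_neg huv, h v hv u hu (Ne.symm huv)]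
  omega

/-- The index set of the double complex `N^{*,*}(K)`. -/
def IsFlag (K : SC) (x : Pr) : Prop := x.1 ⊆ x.2 ∧ x.2 ∈ K.faces ∧ x.1 ≠ ∅

theorem dvL_apply {K : SC} (c : Pr → ℤ) {σ τ : Finset ℕ} (h : K.IsFlag (σ, τ)) :
    dvL ℤ K c (σ, τ) =
      (-1) ^ σ.card * ∑ w ∈ τ \ σ, psgn w τ * c (σ, τ.erase w) := by
  change dvF ℤ K c (σ, τ) = _
  rw [dvF, if_pos ⟨h.2.1, h.1, h.2.2⟩, smul_eq_mul]
  congr 1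
  rw [sdiff_eq_filter, sum_filter]
  refine sum_congr rfl fun w _ => ?_
  have h1 : σ ⊆ τ := h.1
  simp [subset_erase, h1]

theorem dvL_apply_of_not {K : SC} (c : Pr → ℤ) {x : Pr} (h : ¬K.IsFlag x) :
    dvL ℤ K c x = 0 :=
  if_neg fun h' => h ⟨h'.2.1, h'.1, h'.2.2⟩

theorem dhL_apply {K : SC} (c : Pr → ℤ) {σ τ : Finset ℕ} (h : K.IsFlag (σ, τ)) :
    dhL ℤ K c (σ, τ) = ∑ v ∈ τ \ σ, psgn v (insert v σ) * c (insert v σ, τ) :=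
  if_pos ⟨h.2.1, h.1, h.2.2⟩

theorem dhL_apply_of_not {K : SC} (c : Pr → ℤ) {x : Pr} (h : ¬K.IsFlag x) :
    dhL ℤ K c x = 0 :=
  if_neg fun h' => h ⟨h'.2.1, h'.1, h'.2.2⟩

theorem dL_apply (K : SC) (c : Pr → ℤ) (x : Pr) :
    dL ℤ K c x = dhL ℤ K c x + dvL ℤ K c x := rfl

theorem IsFlag.erase_right {K : SC} {σ τ : Finset ℕ} (h : K.IsFlag (σ, τ)) {w : ℕ}
    (hw : w ∈ τ \ σ) : K.IsFlag (σ, τ.erase w) :=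
  ⟨subset_erase.2 ⟨h.1, (mem_sdiff.1 hw).2⟩, K.down_closed h.2.1 (erase_subset _ _), h.2.2⟩

theorem IsFlag.insert_left {K : SC} {σ τ : Finset ℕ} (h : K.IsFlag (σ, τ)) {v : ℕ}
    (hv : v ∈ τ \ σ) : K.IsFlag (insert v σ, τ) :=
  ⟨insert_subset (mem_sdiff.1 hv).1 h.1, h.2.1, insert_ne_empty _ _⟩

theorem dvL_dvL (K : SC) (c : Pr → ℤ) : dvL ℤ K (dvL ℤ K c) = 0 := by
  funext ⟨σ, τ⟩
  by_cases h : K.IsFlag (σ, τ)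
  swap
  · exact dvL_apply_of_not _ h
  rw [dvL_apply _ h]
  have h1 : ∀ w ∈ τ \ σ, psgn w τ * dvL ℤ K c (σ, τ.erase w) =
      ∑ u ∈ (τ \ σ).erase w, (-1) ^ σ.card *
        (psgn w τ * psgn u (τ.erase w) * c (σ, (τ.erase w).erase u)) := by
    intro w hw
    rw [dvL_apply _ (h.erase_right hw), mul_left_comm, mul_sum, mul_sum, erase_sdiff_comm]
    exact sum_congr rfl fun u _ => by ring
  rw [sum_congr rfl h1, sum_erase_antisymm]
  · simp
  · intro u hu v hv huv
    rw [psgn_swap (mem_sdiff.1 hu).1 (mem_sdiff.1 hv).1 huv, erase_right_comm]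
    ring

theorem dhL_dhL (K : SC) (c : Pr → ℤ) : dhL ℤ K (dhL ℤ K c) = 0 := by
  funext ⟨σ, τ⟩
  by_cases h : K.IsFlag (σ, τ)
  swap
  · exact dhL_apply_of_not _ h
  rw [dhL_apply _ h]
  have h1 : ∀ w ∈ τ \ σ, psgn w (insert w σ) * dhL ℤ K c (insert w σ, τ) =
      ∑ u ∈ (τ \ σ).erase w, psgn w (insert w σ) * psgn u (insert u (insert w σ)) *
        c (insert u (insert w σ), τ) := by
    intro w hw
    rw [dhL_apply _ (h.insert_left hw), mul_sum, sdiff_insert]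
    exact sum_congr rfl fun u _ => by ring
  rw [sum_congr rfl h1, sum_erase_antisymm]
  · simp
  · intro u hu v hv huv
    have hu' := (mem_sdiff.1 hu).2
    have hv' := (mem_sdiff.1 hv).2
    have key := psgn_swap (s := insert u (insert v σ)) (u := u) (v := v)
      (by simp) (by simp) huv
    rw [erase_insert (by simp [hu', huv]), insert_comm, erase_insert (by simp [hv', huv.symm])]
      at key
    rw [insert_comm u v]
    linear_combination c (insert v (insert u σ), τ) * key

theorem dvL_dhL (K : SC) (c : Pr → ℤ) : dvL ℤ K (dhL ℤ K c) = -dhL ℤ K (dvL ℤ K c) := by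
  funext ⟨σ, τ⟩
  by_cases h : K.IsFlag (σ, τ)
  swap
  · rw [dvL_apply_of_not _ h, Pi.neg_apply, dhL_apply_of_not _ h, neg_zero]
  rw [dvL_apply _ h, Pi.neg_apply, dhL_apply _ h]
  have h1 : ∀ w ∈ τ \ σ, psgn w τ * dhL ℤ K c (σ, τ.erase w) =
      ∑ v ∈ (τ \ σ).erase w, psgn w τ * (psgn v (insert v σ) *
        c (insert v σ, τ.erase w)) := by
    intro w hw
    rw [dhL_apply _ (h.erase_right hw), mul_sum, erase_sdiff_comm]
  have h2 : ∀ v ∈ τ \ σ, psgn v (insert v σ) * dvL ℤ K c (insert v σ, τ) =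
      ∑ w ∈ (τ \ σ).erase v, -(-1) ^ σ.card * (psgn w τ * (psgn v (insert v σ) *
        c (insert v σ, τ.erase w))) := by
    intro v hv
    rw [dvL_apply _ (h.insert_left hv), sdiff_insert, mul_left_comm, mul_sum, mul_sum,
      card_insert_of_notMem (mem_sdiff.1 hv).2]
    exact sum_congr rfl fun w _ => by ring
  rw [sum_congr rfl h1, sum_congr rfl h2]
  simp only [mul_sum, ← sum_neg_distrib]
  rw [sum_comm' (s' := fun v => (τ \ σ).erase v) (t' := τ \ σ)]
  · exact sum_congr rfl fun v _ => sum_congr rfl fun w _ => by ring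
  · intro u v
    simp only [mem_erase, ne_comm]
    tauto

theorem dL_dL (K : SC) (c : Pr → ℤ) : dL ℤ K (dL ℤ K c) = 0 := by
  have h : dL ℤ K (dL ℤ K c) = dhL ℤ K (dhL ℤ K c) + dhL ℤ K (dvL ℤ K c) +
      (dvL ℤ K (dhL ℤ K c) + dvL ℤ K (dvL ℤ K c)) := by
    simp [dL]
  rw [h, dvL_dvL, dhL_dhL, dvL_dhL]
  simp

theorem exists_of_dvL_ne_zero {K : SC} {c : Pr → ℤ} {σ τ : Finset ℕ}
    (h : dvL ℤ K c (σ, τ) ≠ 0) :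
    K.IsFlag (σ, τ) ∧ ∃ w ∈ τ \ σ, c (σ, τ.erase w) ≠ 0 := by
  by_cases hf : K.IsFlag (σ, τ)
  · refine ⟨hf, ?_⟩
    contrapose! h
    rw [dvL_apply _ hf, sum_eq_zero fun w hw => by rw [h w hw, mul_zero], mul_zero]
  · exact absurd (dvL_apply_of_not _ hf) h

theorem exists_of_dhL_ne_zero {K : SC} {c : Pr → ℤ} {σ τ : Finset ℕ}
    (h : dhL ℤ K c (σ, τ) ≠ 0) :
    K.IsFlag (σ, τ) ∧ ∃ v ∈ τ \ σ, c (insert v σ, τ) ≠ 0 := by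
  by_cases hf : K.IsFlag (σ, τ)
  · refine ⟨hf, ?_⟩
    contrapose! h
    rw [dhL_apply _ hf, sum_eq_zero fun w hw => by rw [h w hw, mul_zero]]
  · exact absurd (dhL_apply_of_not _ hf) h

theorem Tgr.isFlag {K : SC} {m : ℤ} {c : Pr → ℤ} (hc : c ∈ Tgr ℤ K m) {x : Pr}
    (hx : c x ≠ 0) : K.IsFlag x :=
  have h := hc x hx
  ⟨h.1, h.2.1, h.2.2.1⟩

theorem Ngr_le_Tgr (K : SC) (p q : ℤ) : Ngr ℤ K p q ≤ Tgr ℤ K (q - p) := by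
  intro c hc x hx
  obtain ⟨h1, h2, h3, h4, h5⟩ := hc x hx
  exact ⟨h1, h2, h3, by linarith⟩

theorem dL_mem_Tgr {K : SC} {m : ℤ} {c : Pr → ℤ} (hc : c ∈ Tgr ℤ K m) :
    dL ℤ K c ∈ Tgr ℤ K (m + 1) := by
  rintro ⟨σ, τ⟩ hx
  by_cases h : dvL ℤ K c (σ, τ) = 0
  · rw [dL_apply, h, add_zero] at hx
    obtain ⟨hf, v, hv, hcv⟩ := exists_of_dhL_ne_zero hx
    refine ⟨hf.1, hf.2.1, hf.2.2, ?_⟩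
    have h1 := (hc _ hcv).2.2.2
    have h2 := card_insert_of_notMem (mem_sdiff.1 hv).2
    simp only [h2] at h1
    push_cast at h1
    linarith
  · obtain ⟨hf, w, hw, hcw⟩ := exists_of_dvL_ne_zero h
    refine ⟨hf.1, hf.2.1, hf.2.2, ?_⟩
    have h1 := (hc _ hcw).2.2.2
    have h2 := card_erase_add_one (mem_sdiff.1 hw).1
    simp only at h1 ⊢
    omega

end SC

namespace SC

section Abstract

variable {A B : Type} [AddCommGroup A] [AddCommGroup B]

theorem nonempty_quotient_equiv (f : A →ₗ[ℤ] B) (ZA BA : Submodule ℤ A) (ZB BB : Submodule ℤ B)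
    (hZ : ∀ z ∈ ZA, f z ∈ ZB) (hsurj : ∀ b ∈ ZB, ∃ z ∈ ZA, f z = b)
    (hB : ∀ z ∈ ZA, f z ∈ BB ↔ z ∈ BA) :
    Nonempty ((ZA ⧸ BA.comap ZA.subtype) ≃+ (ZB ⧸ BB.comap ZB.subtype)) := by
  let g : ZA →ₗ[ℤ] ZB ⧸ BB.comap ZB.subtype :=
    (BB.comap ZB.subtype).mkQ.comp (f.restrict hZ)
  have hg : Function.Surjective g := by
    refine (Submodule.mkQ_surjective _).comp ?_
    rintro ⟨b, hb⟩
    obtain ⟨z, hz, rfl⟩ := hsurj b hb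
    exact ⟨⟨z, hz⟩, rfl⟩
  have hker : BA.comap ZA.subtype = LinearMap.ker g := by
    ext ⟨z, hz⟩
    rw [LinearMap.mem_ker, LinearMap.comp_apply, Submodule.mkQ_apply,
      Submodule.Quotient.mk_eq_zero]
    exact (hB z hz).symm
  exact ⟨((Submodule.quotEquivOfEq _ _ hker).trans
    (LinearMap.quotKerEquivOfSurjective g hg)).toAddEquiv⟩

/-- A surjective chain map whose kernel is acyclic induces isomorphisms on cohomology. -/
theorem nonempty_cohomology_equiv (D : A →ₗ[ℤ] A) (d : B →ₗ[ℤ] B) (f : A →ₗ[ℤ] B)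
    (TA : ℤ → Submodule ℤ A) (TB : ℤ → Submodule ℤ B) (hDD : ∀ c, D (D c) = 0)
    (hD : ∀ m, ∀ c ∈ TA m, D c ∈ TA (m + 1)) (hf : ∀ m, ∀ c ∈ TA m, f c ∈ TB m)
    (hfD : ∀ m, ∀ c ∈ TA m, f (D c) = d (f c)) (hs : ∀ m, ∀ b ∈ TB m, ∃ c ∈ TA m, f c = b)
    (hk : ∀ m, ∀ c ∈ TA m, D c = 0 → f c = 0 → ∃ x ∈ TA (m - 1), f x = 0 ∧ D x = c)
    (m : ℤ) (BB : Submodule ℤ B)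
    (hBB : ∀ b ∈ TB m, b ∈ BB ↔ ∃ b' ∈ TB (m - 1), d b' = b) :
    Nonempty ((↥(TA m ⊓ LinearMap.ker D) ⧸
        ((TA (m - 1)).map D ⊓ TA m).comap (TA m ⊓ LinearMap.ker D).subtype) ≃+
      (↥(TB m ⊓ LinearMap.ker d) ⧸ BB.comap (TB m ⊓ LinearMap.ker d).subtype)) := by
  refine nonempty_quotient_equiv f _ _ _ _ ?_ ?_ ?_
  · rintro z ⟨hz, hz0⟩
    refine ⟨hf m z hz, ?_⟩
    have hz0' : D z = 0 := hz0
    rw [SetLike.mem_coe, LinearMap.mem_ker, ← hfD m z hz, hz0', map_zero]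
  · rintro b ⟨hb, hb0⟩
    obtain ⟨c, hc, rfl⟩ := hs m b hb
    have hb0' : d (f c) = 0 := hb0
    obtain ⟨x, hx, hfx, hDx⟩ := hk (m + 1) (D c) (hD m c hc) (hDD c) ((hfD m c hc).trans hb0')
    rw [add_sub_cancel_right] at hx
    refine ⟨c - x, ⟨sub_mem hc hx, ?_⟩, by rw [map_sub, hfx, sub_zero]⟩
    rw [SetLike.mem_coe, LinearMap.mem_ker, map_sub, hDx, sub_self]
  · rintro z ⟨hz, hz0⟩
    rw [hBB _ (hf m z hz)]
    constructor
    · rintro ⟨b, hb, hbz⟩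
      obtain ⟨c, hc, rfl⟩ := hs _ b hb
      have hDc : D c ∈ TA m := by simpa using hD _ c hc
      obtain ⟨x, hx, -, hDx⟩ := hk m (z - D c) (sub_mem hz hDc)
        (by rw [map_sub, hDD, sub_zero]; exact hz0)
        (by rw [map_sub, hfD _ c hc, hbz, sub_self])
      exact ⟨⟨x + c, add_mem hx hc, by rw [map_add, hDx, sub_add_cancel]⟩, hz⟩
    · rintro ⟨⟨c, hc, rfl⟩, -⟩
      exact ⟨f c, hf _ c hc, (hfD _ c hc).symm⟩

/-- Acyclicity of the kernel of a chain map can be checked along a finite filtration. -/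
theorem exists_of_filtration (D : A →ₗ[ℤ] A) (f : A →ₗ[ℤ] B) (T₁ T₀ : Submodule ℤ A)
    (F : ℕ → A → Prop) (hDD : ∀ c, D (D c) = 0) (hD : ∀ x ∈ T₀, D x ∈ T₁)
    (hfD : ∀ x ∈ T₀, f x = 0 → f (D x) = 0)
    (hF : ∀ c ∈ T₁, F 0 c → c = 0)
    (hstep : ∀ k, ∀ c ∈ T₁, F (k + 1) c → D c = 0 → f c = 0 →
      ∃ x ∈ T₀, f x = 0 ∧ F k (c - D x)) (k : ℕ) :
    ∀ c ∈ T₁, F k c → D c = 0 → f c = 0 → ∃ x ∈ T₀, f x = 0 ∧ D x = c := by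
  induction k with
  | zero =>
    intro c hc hFc _ _
    exact ⟨0, zero_mem _, map_zero _, by rw [map_zero, hF c hc hFc]⟩
  | succ k ih =>
    intro c hc hFc hDc hfc
    obtain ⟨x, hx, hfx, hFx⟩ := hstep k c hc hFc hDc hfc
    obtain ⟨y, hy, hfy, hDy⟩ := ih (c - D x) (sub_mem hc (hD x hx)) hFx
      (by rw [map_sub, hDD, hDc, sub_zero]) (by rw [map_sub, hfD x hx hfx, hfc, sub_zero])
    exact ⟨y + x, add_mem hy hx, by rw [map_add, hfx, hfy, add_zero],
      by rw [map_add, hDy, sub_add_cancel]⟩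

end Abstract

theorem psgn_singleton (v : ℕ) : psgn v {v} = 1 := by
  rw [psgn, filter_eq_empty_iff.2 (by simp)]
  rfl

/-- The signed augmentation `{v} ⊗ τ ↦ (-1)^{|τ|} τ` of the rows of the double complex. -/
def augL : (Pr → ℤ) →ₗ[ℤ] (Finset ℕ → ℤ) where
  toFun c τ := (-1) ^ τ.card * ∑ v ∈ τ, c ({v}, τ)
  map_add' a b := by
    funext τ
    simp only [Pi.add_apply, sum_add_distrib, mul_add]
  map_smul' z a := by
    funext τ
    simp only [Pi.smul_apply, smul_eq_mul, ← mul_sum, RingHom.id_apply]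
    ring

theorem augL_apply (c : Pr → ℤ) (τ : Finset ℕ) :
    augL c τ = (-1) ^ τ.card * ∑ v ∈ τ, c ({v}, τ) := rfl

theorem augL_dL (K : SC) (c : Pr → ℤ) : augL (dL ℤ K c) = cobL ℤ K (augL c) := by
  funext τ
  change _ = cobF ℤ K (augL c) τ
  rw [augL_apply, cobF]
  by_cases hτ : τ ∈ K.faces
  swap
  · rw [if_neg hτ, sum_eq_zero, mul_zero]
    intro v _
    rw [dL_apply, dhL_apply_of_not _ fun h => hτ h.2.1, dvL_apply_of_not _ fun h => hτ h.2.1,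
      add_zero]
  have hfl : ∀ v ∈ τ, K.IsFlag ({v}, τ) := fun v hv =>
    ⟨singleton_subset_iff.2 hv, hτ, singleton_ne_empty v⟩
  have h1 : ∀ v ∈ τ, dL ℤ K c ({v}, τ) = ∑ u ∈ τ.erase v, psgn u {u, v} * c ({u, v}, τ) +
      ∑ w ∈ τ.erase v, -(psgn w τ * c ({v}, τ.erase w)) := by
    intro v hv
    rw [dL_apply, dhL_apply _ (hfl v hv), dvL_apply _ (hfl v hv), sdiff_singleton_eq_erase]
    simp
  have h2 : ∀ w ∈ τ, (if τ.erase w = ∅ then 0 else psgn w τ • augL c (τ.erase w)) =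
      ∑ v ∈ τ.erase w, (-1) ^ τ.card * -(psgn w τ * c ({v}, τ.erase w)) := by
    intro w hw
    rw [augL_apply, ← card_erase_add_one hw, ← mul_sum, sum_neg_distrib, ← mul_sum]
    split_ifs with h
    · simp [h]
    · rw [smul_eq_mul]; ring
  rw [if_pos hτ, sum_congr rfl h1, sum_congr rfl h2, sum_add_distrib, sum_erase_antisymm,
    zero_add, mul_sum]
  · simp only [mul_sum]
    refine sum_comm' fun u v => ?_
    simp only [mem_erase, ne_comm]
    tauto
  · intro v _ u _ huv
    have key := psgn_swap (s := {u, v}) (u := u) (v := v) (by simp) (by simp) huv.symm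
    rw [erase_insert (by simpa using huv.symm), pair_comm, erase_insert (by simpa using huv),
      psgn_singleton, psgn_singleton, mul_one, mul_one] at key
    rw [pair_comm u v, key]
    ring

theorem augL_mem {K : SC} {m : ℤ} {c : Pr → ℤ} (hc : c ∈ Tgr ℤ K m) :
    augL c ∈ Cgr ℤ K m := by
  intro τ hτ
  obtain ⟨v, hv, hcv⟩ := exists_ne_zero_of_sum_ne_zero (right_ne_zero_of_mul hτ)
  obtain ⟨-, h2, -, h4⟩ := hc _ hcv
  refine ⟨h2, ne_empty_of_mem hv, ?_⟩
  simp only [card_singleton] at h4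
  push_cast at h4
  linarith

open Classical in
/-- A chosen vertex of a nonempty simplex. -/
noncomputable def apex (τ : Finset ℕ) : ℕ := if h : τ.Nonempty then h.choose else 0

theorem apex_mem {τ : Finset ℕ} (h : τ.Nonempty) : apex τ ∈ τ := by
  rw [apex, dif_pos h]
  exact h.choose_spec

/-- The contracting homotopy of the rows: joining with the apex of the second simplex. -/
noncomputable def cone (c : Pr → ℤ) : Pr → ℤ := fun x =>
  if apex x.2 ∈ x.1 then psgn (apex x.2) x.1 * c (x.1.erase (apex x.2), x.2) else 0

theorem sum_cone (c : Pr → ℤ) {σ τ : Finset ℕ} (hτ : τ.Nonempty) (hσ : σ ⊆ τ)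
    (hc : ∀ ρ ⊆ τ, ∑ v ∈ τ \ ρ, psgn v (insert v ρ) * c (insert v ρ, τ) = 0) :
    ∑ v ∈ τ \ σ, psgn v (insert v σ) * cone c (insert v σ, τ) = c (σ, τ) := by
  have ha := apex_mem hτ
  set a := apex τ with ha'
  by_cases h : a ∈ σ
  · have h0 := hc (σ.erase a) ((erase_subset _ _).trans hσ)
    rw [sdiff_erase ha, sum_insert (by simp [h]), insert_erase h] at h0
    have h1 : ∀ v ∈ τ \ σ, psgn v (insert v σ) * cone c (insert v σ, τ) =
        -psgn a σ * (psgn v (insert v (σ.erase a)) * c (insert v (σ.erase a), τ)) := by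
      intro v hv
      have hvs := (mem_sdiff.1 hv).2
      have hva : a ≠ v := fun e => hvs (e ▸ h)
      rw [cone, ← ha', if_pos (mem_insert_of_mem h), erase_insert_of_ne hva.symm]
      have key := psgn_swap (s := insert v σ) (u := v) (v := a) (by simp) (by simp [h]) hva.symm
      rw [erase_insert hvs, erase_insert_of_ne hva.symm] at key
      linear_combination (c (insert v (σ.erase a), τ)) * (psgn a σ * psgn a (insert v σ) * key
        - psgn a σ * psgn v (insert v (σ.erase a)) * psgn_mul_self a (insert v σ)
        - psgn v (insert v σ) * psgn a (insert v σ) * psgn_mul_self a σ)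
    rw [sum_congr rfl h1, ← mul_sum]
    linear_combination -psgn a σ * h0 + c (σ, τ) * psgn_mul_self a σ
  · rw [sum_eq_single_of_mem a (mem_sdiff.2 ⟨ha, h⟩)]
    · rw [cone, ← ha', if_pos (mem_insert_self _ _), erase_insert h, ← mul_assoc, psgn_mul_self,
        one_mul]
    · intro v hv hva
      rw [cone, ← ha', if_neg, mul_zero]
      simp [hva.symm, h]

theorem cone_mem {K : SC} {m : ℤ} {c : Pr → ℤ} (hc : c ∈ Tgr ℤ K m) :
    cone c ∈ Tgr ℤ K (m - 1) := by
  rintro ⟨σ, τ⟩ hx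
  rw [cone] at hx
  obtain ⟨ha, hx⟩ := (ite_ne_right_iff).1 hx
  obtain ⟨h1, h2, h3, h4⟩ := hc _ (right_ne_zero_of_mul hx)
  simp only at ha h1 h2 h3 h4 ⊢
  have h5 := card_erase_add_one ha
  have hτ : τ.Nonempty := (nonempty_iff_ne_empty.2 h3).mono h1
  refine ⟨?_, h2, ne_empty_of_mem ha, by omega⟩
  rw [← insert_erase ha]
  exact insert_subset (apex_mem hτ) h1

theorem augL_cone {K : SC} {m : ℤ} {c : Pr → ℤ} (hc : c ∈ Tgr ℤ K m) : augL (cone c) = 0 := by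
  funext τ
  rw [augL_apply, sum_eq_zero, mul_zero, Pi.zero_apply]
  intro v _
  rw [cone]
  split_ifs with h
  · rw [mem_singleton.1 h, erase_singleton]
    by_contra h'
    exact (hc _ (right_ne_zero_of_mul h')).2.2.1 rfl
  · rfl

theorem exists_augL_eq {K : SC} {m : ℤ} {b : Finset ℕ → ℤ} (hb : b ∈ Cgr ℤ K m) :
    ∃ c ∈ Tgr ℤ K m, augL c = b := by
  refine ⟨fun x => if x.1 = {apex x.2} then (-1) ^ x.2.card * b x.2 else 0, ?_, ?_⟩
  · rintro ⟨σ, τ⟩ hx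
    obtain ⟨h1, hx⟩ := (ite_ne_right_iff).1 hx
    obtain ⟨h2, h3, h4⟩ := hb _ (right_ne_zero_of_mul hx)
    simp only at h1 h2 h3 h4 ⊢
    subst h1
    refine ⟨singleton_subset_iff.2 (apex_mem (nonempty_iff_ne_empty.2 h3)), h2,
      singleton_ne_empty _, ?_⟩
    rw [card_singleton]
    push_cast
    linarith
  · funext τ
    rw [augL_apply]
    simp only [singleton_inj, sum_ite_eq']
    by_cases h : τ.Nonempty
    · rw [if_pos (apex_mem h), ← mul_assoc, ← mul_pow]
      simp
    · rw [not_nonempty_iff_eq_empty] at h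
      subst h
      rw [if_neg (by simp), mul_zero]
      by_contra h'
      exact (hb _ (Ne.symm h')).2.1 rfl

theorem card_le_sup {K : SC} {τ : Finset ℕ} (h : τ ∈ K.faces) :
    τ.card ≤ K.faces.sup Finset.card := le_sup (f := Finset.card) h

theorem exists_dL_eq_of_augL_eq_zero {K : SC} {m : ℤ} {c : Pr → ℤ} (hc : c ∈ Tgr ℤ K m)
    (hDc : dL ℤ K c = 0) (haug : augL c = 0) :
    ∃ x ∈ Tgr ℤ K (m - 1), augL x = 0 ∧ dL ℤ K x = c := by
  refine exists_of_filtration (dL ℤ K) augL (Tgr ℤ K m) (Tgr ℤ K (m - 1))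
    (fun k c => ∀ x, c x ≠ 0 → K.faces.sup Finset.card < x.2.card + k) (dL_dL K)
    (fun x hx => by simpa using dL_mem_Tgr hx)
    (fun x _ h => by rw [augL_dL, h, map_zero]) ?_ ?_ (K.faces.sup Finset.card + 1) c hc ?_ hDc haug
  · intro c hc h
    by_contra hne
    obtain ⟨x, hx⟩ := Function.ne_iff.1 hne
    exact absurd (h x hx) (by simpa using card_le_sup (hc x hx).2.1)
  · intro k c hc hF hDc haug
    refine ⟨cone c, cone_mem hc, augL_cone hc, ?_⟩
    rintro ⟨σ, τ⟩ hx
    by_contra hlt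
    apply hx
    have hlow : ∀ ρ, ∀ w ∈ τ, c (ρ, τ.erase w) = 0 := by
      intro ρ w hw
      by_contra h
      have h1 := hF _ h
      have h2 := card_erase_add_one hw
      simp only at h1 hlt
      omega
    have hflag : K.IsFlag (σ, τ) := by
      have hmem : c - dL ℤ K (cone c) ∈ Tgr ℤ K m :=
        sub_mem hc (by simpa using dL_mem_Tgr (cone_mem hc))
      exact Tgr.isFlag hmem hx
    have hτ : τ.Nonempty := (nonempty_iff_ne_empty.2 hflag.2.2).mono hflag.1
    rw [Pi.sub_apply, dL_apply, dhL_apply _ hflag, sum_cone c hτ hflag.1, dvL_apply _ hflag,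
      sum_eq_zero, mul_zero, add_zero, sub_self]
    · intro w hw
      have hw' := (mem_sdiff.1 hw).1
      rw [cone]
      split_ifs
      · rw [hlow _ _ hw', mul_zero, mul_zero]
      · exact mul_zero _
    · intro ρ hρ
      by_cases hρ0 : ρ = ∅
      · subst hρ0
        have h := congrFun haug τ
        rw [augL_apply, Pi.zero_apply, mul_eq_zero] at h
        simpa [psgn_singleton] using h
      · have hf : K.IsFlag (ρ, τ) := ⟨hρ, hflag.2.1, hρ0⟩
        have h := congrFun hDc (ρ, τ)
        rw [dL_apply, dvL_apply _ hf, dhL_apply _ hf, sum_eq_zero (s := τ \ ρ)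
          (f := fun w => psgn w τ * c (ρ, τ.erase w)), mul_zero, add_zero] at h
        · exact h
        · intro w hw
          rw [hlow _ _ (mem_sdiff.1 hw).1, mul_zero]
  · intro x _
    omega

theorem nonempty_totH_equiv_coh (K : SC) (m : ℤ) : Nonempty (TotH ℤ K m ≃+ coh ℤ K m) :=
  nonempty_cohomology_equiv (dL ℤ K) (cobL ℤ K) augL (Tgr ℤ K) (Cgr ℤ K) (dL_dL K)
    (fun _ _ => dL_mem_Tgr) (fun _ _ => augL_mem) (fun _ _ _ => augL_dL K _)
    (fun _ _ => exists_augL_eq) (fun _ _ => exists_dL_eq_of_augL_eq_zero) m _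
    fun _ _ => Iff.rfl

end SC

namespace SC

theorem mem_link {K : SC} {σ t : Finset ℕ} :
    t ∈ (K.link σ).faces ↔ σ ∪ t ∈ K.faces ∧ Disjoint σ t := by
  change t ∈ K.faces.filter _ ↔ _
  rw [mem_filter]
  exact ⟨fun h => h.2, fun h => ⟨K.down_closed h.1 subset_union_right, h⟩⟩

theorem mem_verts {K : SC} {v : ℕ} {τ : Finset ℕ} (hτ : τ ∈ K.faces) (hv : v ∈ τ) :
    v ∈ K.verts := mem_sup.2 ⟨τ, hτ, hv⟩

theorem psgn_union {σ t : Finset ℕ} (h : Disjoint σ t) (w : ℕ) :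
    psgn w (σ ∪ t) = psgn w σ * psgn w t := by
  rw [psgn, psgn, psgn, filter_union, card_union_of_disjoint (disjoint_filter_filter h), pow_add]

/-- The sign of the shuffle relating the ordering of `σ ∪ t` with those of `σ` and `t`. -/
def joinSgn (σ t : Finset ℕ) : ℤ := ∏ w ∈ t, psgn w σ

theorem joinSgn_mul_self (σ t : Finset ℕ) : joinSgn σ t * joinSgn σ t = 1 := by
  rw [joinSgn, ← prod_mul_distrib]
  exact prod_eq_one fun w _ => psgn_mul_self w σ

theorem joinSgn_erase (σ : Finset ℕ) {t : Finset ℕ} {w : ℕ} (hw : w ∈ t) :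
    joinSgn σ (t.erase w) = psgn w σ * joinSgn σ t := by
  rw [joinSgn, joinSgn, ← mul_prod_erase t _ hw, ← mul_assoc, psgn_mul_self, one_mul]

/-- Restriction of a cochain on the open star of `σ` to a cochain on the link. -/
def toLink (σ : Finset ℕ) (K : SC) (a : Finset ℕ → ℤ) : Finset ℕ → ℤ := fun t =>
  if t ∈ (K.link σ).faces then joinSgn σ t * a (σ ∪ t) else 0

/-- Extension of a cochain on the link of `σ` to a cochain on the open star. -/
def ofLink (σ : Finset ℕ) : (Finset ℕ → ℤ) →ₗ[ℤ] (Finset ℕ → ℤ) where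
  toFun b τ := if σ ⊆ τ then joinSgn σ (τ \ σ) * b (τ \ σ) else 0
  map_add' a b := by
    funext τ
    simp only [Pi.add_apply]
    split_ifs <;> ring
  map_smul' z a := by
    funext τ
    simp only [Pi.smul_apply, smul_eq_mul, RingHom.id_apply]
    split_ifs <;> ring

theorem ofLink_apply (b : Finset ℕ → ℤ) {σ τ : Finset ℕ} (h : σ ⊆ τ) :
    ofLink σ b τ = joinSgn σ (τ \ σ) * b (τ \ σ) := if_pos h

theorem sdiff_mem_link {K : SC} {σ τ : Finset ℕ} (hτ : τ ∈ K.faces) (h : σ ⊆ τ) :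
    τ \ σ ∈ (K.link σ).faces :=
  mem_link.2 ⟨by rwa [union_sdiff_of_subset h], disjoint_sdiff⟩

theorem toLink_ofLink {K : SC} {σ : Finset ℕ} {i : ℤ} {b : Finset ℕ → ℤ}
    (hb : b ∈ CgrR ℤ (K.link σ) i) : toLink σ K (ofLink σ b) = b := by
  funext t
  rw [toLink]
  split_ifs with h
  · rw [ofLink_apply _ subset_union_left, union_sdiff_cancel_left (mem_link.1 h).2, ← mul_assoc,
      joinSgn_mul_self, one_mul]
  · by_contra h'
    exact h (hb t (Ne.symm h')).1

theorem ofLink_toLink {K : SC} {σ : Finset ℕ} {a : Finset ℕ → ℤ}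
    (ha : ∀ τ, a τ ≠ 0 → σ ⊆ τ ∧ τ ∈ K.faces) : ofLink σ (toLink σ K a) = a := by
  funext τ
  by_cases h : σ ⊆ τ ∧ τ ∈ K.faces
  · rw [ofLink_apply _ h.1, toLink, if_pos (sdiff_mem_link h.2 h.1), ← mul_assoc,
      joinSgn_mul_self, one_mul, union_sdiff_of_subset h.1]
  · have h0 : a τ = 0 := by
      by_contra h'
      exact h (ha τ h')
    by_cases hσ : σ ⊆ τ
    · rw [ofLink_apply _ hσ, toLink, if_neg, mul_zero, h0]
      intro h'
      refine h ⟨hσ, ?_⟩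
      simpa [union_sdiff_of_subset hσ] using (mem_link.1 h').1
    · rw [h0]
      exact if_neg hσ

theorem toLink_mem {K : SC} {σ : Finset ℕ} {q : ℤ} {a : Finset ℕ → ℤ}
    (ha : ∀ τ, a τ ≠ 0 → (τ.card : ℤ) = q + 1) :
    toLink σ K a ∈ CgrR ℤ (K.link σ) (q - σ.card) := by
  intro t ht
  obtain ⟨h1, h2⟩ := ite_ne_right_iff.1 ht
  refine ⟨h1, ?_⟩
  have h3 := ha _ (right_ne_zero_of_mul h2)
  rw [card_union_of_disjoint (mem_link.1 h1).2] at h3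
  push_cast at h3
  linarith

theorem ofLink_card {K : SC} {σ : Finset ℕ} {i : ℤ} {b : Finset ℕ → ℤ}
    (hb : b ∈ CgrR ℤ (K.link σ) i) {τ : Finset ℕ} (h : ofLink σ b τ ≠ 0) :
    σ ⊆ τ ∧ τ ∈ K.faces ∧ (τ.card : ℤ) = σ.card + i + 1 := by
  obtain ⟨h1, h2⟩ := ite_ne_right_iff.1 h
  obtain ⟨h3, h4⟩ := hb _ (right_ne_zero_of_mul h2)
  have h5 := (mem_link.1 h3).1
  rw [union_sdiff_of_subset h1] at h5
  have h6 := card_sdiff_add_card_eq_card h1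
  refine ⟨h1, h5, ?_⟩
  omega

theorem cobRL_toLink {K : SC} {σ t : Finset ℕ} (a : Finset ℕ → ℤ)
    (ht : t ∈ (K.link σ).faces) :
    cobRL ℤ (K.link σ) (toLink σ K a) t =
      joinSgn σ t * ∑ w ∈ t, psgn w (σ ∪ t) * a ((σ ∪ t).erase w) := by
  refine (if_pos ht).trans ?_
  rw [mul_sum]
  refine sum_congr rfl fun w hw => ?_
  have hd := (mem_link.1 ht).2
  have hwσ : w ∉ σ := fun h => disjoint_left.1 hd h hw
  rw [toLink, if_pos ((K.link σ).down_closed ht (erase_subset _ _)), joinSgn_erase σ hw,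
    psgn_union hd, erase_union_distrib, erase_eq_of_notMem hwσ, smul_eq_mul]
  ring

theorem ofLink_cobRL {K : SC} {σ τ : Finset ℕ} {i : ℤ} {b : Finset ℕ → ℤ}
    (hb : b ∈ CgrR ℤ (K.link σ) i) (hτ : τ ∈ K.faces) (h : σ ⊆ τ) :
    ofLink σ (cobRL ℤ (K.link σ) b) τ =
      ∑ w ∈ τ \ σ, psgn w τ * ofLink σ b (τ.erase w) := by
  conv_lhs => rw [← toLink_ofLink hb]
  rw [ofLink_apply _ h, cobRL_toLink _ (sdiff_mem_link hτ h), ← mul_assoc, joinSgn_mul_self,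
    one_mul, union_sdiff_of_subset h]

theorem cobRL_toLink_eq_zero {K : SC} {σ : Finset ℕ} {a : Finset ℕ → ℤ}
    (ha : ∀ τ ∈ K.faces, σ ⊆ τ → ∑ w ∈ τ \ σ, psgn w τ * a (τ.erase w) = 0) :
    cobRL ℤ (K.link σ) (toLink σ K a) = 0 := by
  funext t
  by_cases ht : t ∈ (K.link σ).faces
  · have h := mem_link.1 ht
    have h' := ha _ h.1 subset_union_left
    rw [union_sdiff_cancel_left h.2] at h'
    rw [cobRL_toLink _ ht, h', mul_zero, Pi.zero_apply]
  · exact if_neg ht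

theorem sum_faces_erase (K : SC) (F : Finset ℕ → ℕ → ℤ) :
    ∑ τ ∈ K.faces, ∑ w ∈ τ, F τ w =
      ∑ ρ ∈ K.faces, ∑ v ∈ K.verts \ ρ,
        if insert v ρ ∈ K.faces then F (insert v ρ) v else 0 := by
  simp only [← sum_filter]
  rw [sum_sigma', sum_sigma']
  refine sum_bij' (fun x _ => ⟨x.1.erase x.2, x.2⟩) (fun x _ => ⟨insert x.2 x.1, x.2⟩)
    ?_ ?_ ?_ ?_ ?_
  · rintro ⟨τ, w⟩ h
    simp only [mem_sigma, mem_filter, mem_sdiff] at h ⊢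
    refine ⟨K.down_closed h.1 (erase_subset _ _), ⟨mem_verts h.1 h.2, notMem_erase _ _⟩, ?_⟩
    rw [insert_erase h.2]
    exact h.1
  · rintro ⟨ρ, v⟩ h
    simp only [mem_sigma, mem_filter, mem_sdiff] at h ⊢
    exact ⟨h.2.2, mem_insert_self _ _⟩
  · rintro ⟨τ, w⟩ h
    simp only [mem_sigma] at h
    simp only [insert_erase h.2]
  · rintro ⟨ρ, v⟩ h
    simp only [mem_sigma, mem_filter, mem_sdiff] at h
    simp only [erase_insert h.2.1.2]
  · rintro ⟨τ, w⟩ h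
    simp only [mem_sigma] at h
    simp only [insert_erase h.2]

theorem sum_cycle_mul_coboundary {K B : SC} {ω : Finset ℕ → ℤ} (hω : bdRelL K B ω = 0)
    {σ : Finset ℕ} (hσ : σ ≠ ∅) (hσB : σ ∉ B.faces) (b : Finset ℕ → ℤ) :
    ∑ τ ∈ K.faces, ω τ *
      (if σ ⊆ τ then ∑ w ∈ τ \ σ, psgn w τ * b (τ.erase w) else 0) = 0 := by
  have h1 : ∀ τ ∈ K.faces, ω τ *
      (if σ ⊆ τ then ∑ w ∈ τ \ σ, psgn w τ * b (τ.erase w) else 0) =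
      ∑ w ∈ τ, if σ ⊆ τ.erase w then ω τ * (psgn w τ * b (τ.erase w)) else 0 := by
    intro τ _
    split_ifs with h
    · rw [mul_sum, sdiff_eq_filter, sum_filter]
      refine sum_congr rfl fun w _ => ?_
      simp [subset_erase, h]
    · rw [mul_zero, sum_eq_zero]
      intro w _
      exact if_neg fun h' => h (h'.trans (erase_subset _ _))
  rw [sum_congr rfl h1, sum_faces_erase K
    fun τ w => if σ ⊆ τ.erase w then ω τ * (psgn w τ * b (τ.erase w)) else 0]
  refine sum_eq_zero fun ρ hρ => ?_
  by_cases h : σ ⊆ ρ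
  · have hρ' : bdRelF K B ω ρ = 0 := congrFun hω ρ
    rw [bdRelF, if_pos ⟨hρ, fun h' => hσB (B.down_closed h' h),
      ((nonempty_iff_ne_empty.2 hσ).mono h).ne_empty⟩] at hρ'
    have h2 := congrArg (b ρ * ·) hρ'
    simp only [mul_sum, mul_zero] at h2
    refine (sum_congr rfl fun v hv => ?_).trans h2
    rw [erase_insert (mem_sdiff.1 hv).2, if_pos h]
    split_ifs <;> ring
  · refine sum_eq_zero fun v hv => ?_
    rw [erase_insert (mem_sdiff.1 hv).2, if_neg h, ite_self]

/-- Evaluation of the second tensor factor on the fundamental cycle `ω`. -/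
def evL (K B : SC) (ω : Finset ℕ → ℤ) : (Pr → ℤ) →ₗ[ℤ] (Finset ℕ → ℤ) where
  toFun c σ := if σ ∈ B.faces then 0 else ∑ τ ∈ K.faces, ω τ * c (σ, τ)
  map_add' a b := by
    funext σ
    simp only [Pi.add_apply, mul_add, sum_add_distrib]
    split_ifs <;> ring
  map_smul' z a := by
    funext σ
    simp only [Pi.smul_apply, smul_eq_mul, RingHom.id_apply, mul_left_comm, ← mul_sum]
    split_ifs <;> ring

theorem evL_apply (K : SC) {B : SC} (ω : Finset ℕ → ℤ) (c : Pr → ℤ) {σ : Finset ℕ}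
    (h : σ ∉ B.faces) : evL K B ω c σ = ∑ τ ∈ K.faces, ω τ * c (σ, τ) := if_neg h

theorem evL_apply_of_mem (K : SC) {B : SC} (ω : Finset ℕ → ℤ) (c : Pr → ℤ) {σ : Finset ℕ}
    (h : σ ∈ B.faces) : evL K B ω c σ = 0 := if_pos h

theorem evL_dvL {K B : SC} {ω : Finset ℕ → ℤ} (hω : bdRelL K B ω = 0) (c : Pr → ℤ) :
    evL K B ω (dvL ℤ K c) = 0 := by
  funext σ
  rw [Pi.zero_apply]
  by_cases hB : σ ∈ B.faces
  · exact evL_apply_of_mem K ω _ hB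
  rw [evL_apply K ω _ hB]
  by_cases hσ : σ = ∅
  · exact sum_eq_zero fun τ _ => by rw [dvL_apply_of_not _ fun h => h.2.2 hσ, mul_zero]
  rw [← mul_zero ((-1 : ℤ) ^ σ.card),
    ← sum_cycle_mul_coboundary hω hσ hB fun τ => c (σ, τ), mul_sum]
  refine sum_congr rfl fun τ hτ => ?_
  split_ifs with h
  · rw [dvL_apply _ ⟨h, hτ, hσ⟩]
    ring
  · rw [dvL_apply_of_not _ fun h' => h h'.1, mul_zero, mul_zero]

theorem evL_dhL {K B : SC} (ω : Finset ℕ → ℤ) {c : Pr → ℤ} (hc : ∀ x, c x ≠ 0 → K.IsFlag x) :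
    evL K B ω (dhL ℤ K c) = bdRelL K B (evL K B ω c) := by
  funext σ
  change _ = bdRelF K B (evL K B ω c) σ
  rw [bdRelF]
  by_cases hB : σ ∈ B.faces
  · rw [evL_apply_of_mem K ω _ hB, if_neg fun h => h.2.1 hB]
  rw [evL_apply K ω _ hB]
  by_cases hσ : σ ∈ K.faces ∧ σ ≠ ∅
  swap
  · rw [if_neg fun h => hσ ⟨h.1, h.2.2⟩]
    refine sum_eq_zero fun τ hτ => ?_
    rw [dhL_apply_of_not _ fun h => hσ ⟨K.down_closed h.2.1 h.1, h.2.2⟩, mul_zero]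
  rw [if_pos ⟨hσ.1, hB, hσ.2⟩]
  have h1 : ∀ τ ∈ K.faces, ω τ * dhL ℤ K c (σ, τ) =
      ∑ v ∈ K.verts \ σ, ω τ * (psgn v (insert v σ) * c (insert v σ, τ)) := by
    intro τ hτ
    rw [← mul_sum]
    congr 1
    by_cases h : σ ⊆ τ
    · rw [dhL_apply _ ⟨h, hτ, hσ.2⟩]
      refine sum_subset (sdiff_subset_sdiff (fun v hv => mem_verts hτ hv) subset_rfl) ?_
      intro v hv hv'
      by_contra h'
      have h2 := (hc _ (right_ne_zero_of_mul h')).1 (mem_insert_self v σ)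
      exact hv' (mem_sdiff.2 ⟨h2, (mem_sdiff.1 hv).2⟩)
    · rw [dhL_apply_of_not _ fun h' => h h'.1, sum_eq_zero]
      intro v _
      by_contra h'
      exact h ((subset_insert v σ).trans (hc _ (right_ne_zero_of_mul h')).1)
  rw [sum_congr rfl h1, sum_comm]
  refine sum_congr rfl fun v _ => ?_
  split_ifs with h
  · rw [evL_apply K ω _ fun h' => hB (B.down_closed h' (subset_insert v σ)), mul_sum]
    exact sum_congr rfl fun τ _ => by ring
  · refine sum_eq_zero fun τ _ => ?_
    by_contra h'
    have h2 := hc _ (right_ne_zero_of_mul (right_ne_zero_of_mul h'))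
    exact h (K.down_closed h2.2.1 h2.1)

theorem mem_of_subsingleton_quotient {A : Type} [AddCommGroup A] {Z S : Submodule ℤ A}
    (h : Subsingleton (Z ⧸ S.comap Z.subtype)) {z : A} (hz : z ∈ Z) : z ∈ S :=
  (Submodule.Quotient.mk_eq_zero (S.comap Z.subtype) (x := ⟨z, hz⟩)).1 (Subsingleton.elim _ _)

/-- A nonzero functional detects the classes of an infinite cyclic quotient. -/
theorem mem_of_functional_eq_zero {A : Type} [AddCommGroup A] {Z S : Submodule ℤ A}
    (e : (Z ⧸ S.comap Z.subtype) ≃+ ℤ) (φ : A →ₗ[ℤ] ℤ) (hφ : ∀ z ∈ S, φ z = 0)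
    {z₀ : A} (hz₀ : z₀ ∈ Z) (h₀ : φ z₀ ≠ 0) {z : A} (hz : z ∈ Z) (h : φ z = 0) : z ∈ S := by
  let ψ : (Z ⧸ S.comap Z.subtype) →ₗ[ℤ] ℤ :=
    (S.comap Z.subtype).liftQ (φ.comp Z.subtype) fun y hy => hφ _ hy
  let g : ℤ →+ ℤ := ψ.toAddMonoidHom.comp e.symm.toAddMonoidHom
  have hg : ∀ y : Z, g (e (Submodule.Quotient.mk y)) = φ y := by
    intro y
    change ψ (e.symm (e _)) = _
    rw [e.symm_apply_apply]
    rfl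
  have hlin : ∀ k : ℤ, g k = k * g 1 := by
    intro k
    rw [← smul_eq_mul, ← map_zsmul, smul_eq_mul, mul_one]
  have h1 : g 1 ≠ 0 := by
    intro h1
    apply h₀
    rw [← hg ⟨z₀, hz₀⟩, hlin, h1, mul_zero]
  have h2 := hg ⟨z, hz⟩
  rw [hlin, h, mul_eq_zero, or_iff_left h1, EmbeddingLike.map_eq_zero_iff,
    Submodule.Quotient.mk_eq_zero] at h2
  exact h2

end SC

namespace SC

/-- `K` is a pure combinatorial homology `n`-manifold with boundary `B` and fundamental
cycle `ω`. -/
structure IsOrientedBy (K B : SC) (n : ℕ) (ω : Finset ℕ → ℤ) : Prop where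
  card_le : ∀ τ ∈ K.faces, τ.card ≤ n + 1
  pure : ∀ σ ∈ K.faces, ∃ τ ∈ K.faces, σ ⊆ τ ∧ τ.card = n + 1
  interior : ∀ σ ∈ K.faces, σ ≠ ∅ → σ ∉ B.faces →
    Nonempty (cohR ℤ (K.link σ) ((n : ℤ) - σ.card) ≃+ ℤ) ∧
      ∀ i : ℤ, i ≠ (n : ℤ) - σ.card → Subsingleton (cohR ℤ (K.link σ) i)
  boundary : ∀ σ ∈ K.faces, σ ≠ ∅ → σ ∈ B.faces →
    ∀ i : ℤ, Subsingleton (cohR ℤ (K.link σ) i)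
  mem_RelC : ω ∈ RelC K B n
  cycle : bdRelL K B ω = 0
  unit : ∀ σ ∈ K.faces, σ.card = n + 1 → σ ∉ B.faces → ω σ = 1 ∨ ω σ = -1

namespace IsOrientedBy

variable {K B : SC} {n : ℕ} {ω : Finset ℕ → ℤ}

theorem mul_self (hK : K.IsOrientedBy B n ω) {σ τ : Finset ℕ} (hσ : σ ∉ B.faces) (h : σ ⊆ τ)
    (hτ : τ ∈ K.faces) (hcard : τ.card = n + 1) : ω τ * ω τ = 1 := by
  rcases hK.unit τ hτ hcard fun h' => hσ (B.down_closed h' h) with h | h <;> rw [h] <;> rfl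

theorem card_eq (hK : K.IsOrientedBy B n ω) {τ : Finset ℕ} (h : ω τ ≠ 0) :
    τ.card = n + 1 := by
  have := (hK.mem_RelC τ h).2.2.2
  omega

theorem toLink_mem_map_cobRL (hK : K.IsOrientedBy B n ω) {σ : Finset ℕ} (hσK : σ ∈ K.faces)
    (hσ : σ ≠ ∅) {q : ℤ} {a : Finset ℕ → ℤ}
    (ha : ∀ τ, a τ ≠ 0 → σ ⊆ τ ∧ τ ∈ K.faces ∧ (τ.card : ℤ) = q + 1)
    (hcoc : ∀ τ ∈ K.faces, σ ⊆ τ → ∑ w ∈ τ \ σ, psgn w τ * a (τ.erase w) = 0)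
    (hev : σ ∉ B.faces → ∑ τ ∈ K.faces, ω τ * a τ = 0) :
    toLink σ K a ∈ (CgrR ℤ (K.link σ) (q - σ.card - 1)).map (cobRL ℤ (K.link σ)) := by
  have hZ : toLink σ K a ∈
      CgrR ℤ (K.link σ) (q - σ.card) ⊓ LinearMap.ker (cobRL ℤ (K.link σ)) :=
    ⟨toLink_mem fun τ h => (ha τ h).2.2, cobRL_toLink_eq_zero hcoc⟩
  by_cases hB : σ ∈ B.faces
  · exact mem_of_subsingleton_quotient (hK.boundary σ hσK hσ hB _) hZ
  by_cases hq : q = n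
  swap
  · exact mem_of_subsingleton_quotient
      ((hK.interior σ hσK hσ hB).2 _ fun h => hq (sub_left_injective h)) hZ
  subst hq
  obtain ⟨e⟩ := (hK.interior σ hσK hσ hB).1
  let φ : (Finset ℕ → ℤ) →ₗ[ℤ] ℤ :=
    (∑ τ ∈ K.faces, ω τ • LinearMap.proj τ).comp (ofLink σ)
  have hφ : ∀ b, φ b = ∑ τ ∈ K.faces, ω τ * ofLink σ b τ := by
    intro b
    simp [φ]
  obtain ⟨τ₀, hτ₀, hστ₀, hcard⟩ := hK.pure σ hσK
  let a₀ : Finset ℕ → ℤ := Pi.single τ₀ 1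
  have ha₀ : ∀ τ, a₀ τ ≠ 0 → τ = τ₀ := by
    intro τ h
    by_contra h'
    exact h (Pi.single_eq_of_ne h' 1)
  refine mem_of_functional_eq_zero e φ ?_ (z₀ := toLink σ K a₀) ⟨?_, ?_⟩ ?_ hZ ?_
  · rintro _ ⟨b, hb, rfl⟩
    rw [hφ, ← sum_cycle_mul_coboundary hK.cycle hσ hB (ofLink σ b)]
    refine sum_congr rfl fun τ hτ => ?_
    split_ifs with h
    · rw [ofLink_cobRL hb hτ h]
    · exact congrArg _ (if_neg h)
  · refine toLink_mem fun τ h => ?_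
    rw [ha₀ τ h, hcard]
    push_cast
    rfl
  · refine cobRL_toLink_eq_zero fun τ hτ _ => sum_eq_zero fun w hw => ?_
    by_contra h
    have h1 := ha₀ _ (right_ne_zero_of_mul h)
    have h2 := card_erase_add_one (mem_sdiff.1 hw).1
    have h3 := hK.card_le τ hτ
    rw [h1] at h2
    omega
  · rw [hφ, ofLink_toLink, sum_eq_single_of_mem τ₀ hτ₀]
    · rw [show a₀ τ₀ = 1 from Pi.single_eq_same τ₀ 1, mul_one]
      exact left_ne_zero_of_mul_eq_one (hK.mul_self hB hστ₀ hτ₀ hcard)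
    · intro τ _ h
      rw [show a₀ τ = 0 from Pi.single_eq_of_ne h 1, mul_zero]
    · intro τ h
      rw [ha₀ τ h]
      exact ⟨hστ₀, hτ₀⟩
  · rw [hφ, ofLink_toLink fun τ h => ⟨(ha τ h).1, (ha τ h).2.1⟩]
    exact hev hB

theorem exists_star_primitive (hK : K.IsOrientedBy B n ω) {σ : Finset ℕ} (hσK : σ ∈ K.faces)
    (hσ : σ ≠ ∅) {q : ℤ} {a : Finset ℕ → ℤ}
    (ha : ∀ τ, a τ ≠ 0 → σ ⊆ τ ∧ τ ∈ K.faces ∧ (τ.card : ℤ) = q + 1)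
    (hcoc : ∀ τ ∈ K.faces, σ ⊆ τ → ∑ w ∈ τ \ σ, psgn w τ * a (τ.erase w) = 0)
    (hev : σ ∉ B.faces → ∑ τ ∈ K.faces, ω τ * a τ = 0) :
    ∃ b : Finset ℕ → ℤ, (∀ τ, b τ ≠ 0 → σ ⊆ τ ∧ τ ∈ K.faces ∧ (τ.card : ℤ) = q) ∧
      (∀ τ ∈ K.faces, σ ⊆ τ → ∑ w ∈ τ \ σ, psgn w τ * b (τ.erase w) = a τ) ∧
      ∑ τ ∈ K.faces, ω τ * b τ = 0 := by
  by_cases hq : (n : ℤ) < q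
  · have ha0 : ∀ τ, a τ = 0 := by
      intro τ
      by_contra h
      have h1 := ha τ h
      have h2 := hK.card_le τ h1.2.1
      omega
    exact ⟨0, fun τ h => absurd rfl h, fun τ _ _ => by simp [ha0], by simp⟩
  obtain ⟨b, hb, hab⟩ := hK.toLink_mem_map_cobRL hσK hσ ha hcoc hev
  have hsupp : ∀ τ, ofLink σ b τ ≠ 0 → σ ⊆ τ ∧ τ ∈ K.faces ∧ (τ.card : ℤ) = q := by
    intro τ h
    obtain ⟨h1, h2, h3⟩ := ofLink_card hb h
    exact ⟨h1, h2, by linarith⟩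
  refine ⟨ofLink σ b, hsupp, fun τ hτ h => ?_, sum_eq_zero fun τ _ => ?_⟩
  · rw [← ofLink_cobRL hb hτ h, hab, ofLink_toLink fun τ h => ⟨(ha τ h).1, (ha τ h).2.1⟩]
  · by_contra h
    have h1 := hK.card_eq (left_ne_zero_of_mul h)
    have h2 := (hsupp τ (right_ne_zero_of_mul h)).2.2
    omega

/-- The columns of the double complex are exact on the kernel of `evL`. -/
theorem exists_dvL_eq (hK : K.IsOrientedBy B n ω) {p q : ℤ} {c : Pr → ℤ}
    (hc : c ∈ Ngr ℤ K p q) (hdc : dvL ℤ K c = 0) (hev : evL K B ω c = 0) :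
    ∃ x ∈ Ngr ℤ K p (q - 1), evL K B ω x = 0 ∧ dvL ℤ K x = c := by
  have hcol : ∀ σ, ∃ b : Finset ℕ → ℤ,
      (∀ τ, b τ ≠ 0 → K.IsFlag (σ, τ) ∧ (σ.card : ℤ) = p + 1 ∧ (τ.card : ℤ) = q) ∧
      (∀ τ, K.IsFlag (σ, τ) → ∑ w ∈ τ \ σ, psgn w τ * b (τ.erase w) = c (σ, τ)) ∧
      ∑ τ ∈ K.faces, ω τ * b τ = 0 := by
    intro σ
    by_cases hσ : σ ∈ K.faces ∧ σ ≠ ∅ ∧ (σ.card : ℤ) = p + 1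
    · obtain ⟨b, hb, hdb, hb0⟩ := hK.exists_star_primitive hσ.1 hσ.2.1 (q := q)
        (a := fun τ => c (σ, τ))
        (fun τ h => ⟨(hc _ h).1, (hc _ h).2.1, (hc _ h).2.2.2.2⟩)
        (fun τ hτ h => by
          have h1 := congrFun hdc (σ, τ)
          rw [dvL_apply _ ⟨h, hτ, hσ.2.1⟩] at h1
          simpa using h1)
        (fun h => by rw [← evL_apply K ω c h, hev]; rfl)
      exact ⟨b, fun τ h => ⟨⟨(hb τ h).1, (hb τ h).2.1, hσ.2.1⟩, hσ.2.2, (hb τ h).2.2⟩,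
        fun τ h => hdb τ h.2.1 h.1, hb0⟩
    · refine ⟨0, fun τ h => absurd rfl h, fun τ h => ?_, by simp⟩
      have h0 : c (σ, τ) = 0 := by
        by_contra h'
        exact hσ ⟨K.down_closed h.2.1 h.1, h.2.2, (hc _ h').2.2.2.1⟩
      simp [h0]
  choose b hb hdb hb0 using hcol
  refine ⟨fun x => (-1) ^ x.1.card * b x.1 x.2, ?_, ?_, ?_⟩
  · rintro ⟨σ, τ⟩ hx
    obtain ⟨h1, h2, h3⟩ := hb σ τ (right_ne_zero_of_mul hx)
    exact ⟨h1.1, h1.2.1, h1.2.2, h2, by simpa using h3⟩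
  · funext σ
    by_cases hB : σ ∈ B.faces
    · exact evL_apply_of_mem K ω _ hB
    · rw [evL_apply K ω _ hB, Pi.zero_apply, ← mul_zero ((-1 : ℤ) ^ σ.card), ← hb0 σ, mul_sum]
      exact sum_congr rfl fun τ _ => by ring
  · funext ⟨σ, τ⟩
    by_cases h : K.IsFlag (σ, τ)
    · rw [dvL_apply _ h, ← hdb σ τ h, mul_sum]
      refine sum_congr rfl fun w _ => ?_
      have h1 : (-1 : ℤ) ^ σ.card * (-1) ^ σ.card = 1 := by rw [← mul_pow]; simp
      linear_combination psgn w τ * b σ (τ.erase w) * h1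
    · rw [dvL_apply_of_not _ h]
      by_contra h'
      have h1 := hc _ (Ne.symm h')
      exact h ⟨h1.1, h1.2.1, h1.2.2.1⟩

theorem evL_mem (hK : K.IsOrientedBy B n ω) {m : ℤ} {c : Pr → ℤ} (hc : c ∈ Tgr ℤ K m) :
    evL K B ω c ∈ RelC K B (n - m) := by
  intro σ hσ
  by_cases hB : σ ∈ B.faces
  · exact absurd (evL_apply_of_mem K ω c hB) hσ
  rw [evL_apply K ω c hB] at hσ
  obtain ⟨τ, hτ, h⟩ := exists_ne_zero_of_sum_ne_zero hσ
  obtain ⟨h1, -, h3, h4⟩ := hc _ (right_ne_zero_of_mul h)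
  have h5 := hK.card_eq (left_ne_zero_of_mul h)
  simp only at h1 h3 h4
  exact ⟨K.down_closed hτ h1, hB, h3, by omega⟩

theorem exists_evL_eq (hK : K.IsOrientedBy B n ω) {p : ℤ} {b : Finset ℕ → ℤ}
    (hb : b ∈ RelC K B p) : ∃ c ∈ Ngr ℤ K p n, evL K B ω c = b := by
  choose! T hT hsub hcard using hK.pure
  refine ⟨fun x => if x.2 = T x.1 then ω x.2 * b x.1 else 0, ?_, ?_⟩
  · rintro ⟨σ, τ⟩ hx
    obtain ⟨h1, h2⟩ := ite_ne_right_iff.1 hx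
    obtain ⟨h3, h4, h5, h6⟩ := hb _ (right_ne_zero_of_mul h2)
    simp only at h1 h3 h5 h6
    subst h1
    refine ⟨hsub σ h3, hT σ h3, h5, h6, ?_⟩
    simp only [hcard σ h3]
    push_cast
    rfl
  · funext σ
    by_cases h : b σ = 0
    · by_cases hB : σ ∈ B.faces
      · rw [evL_apply_of_mem K ω _ hB, h]
      · rw [evL_apply K ω _ hB, h]
        exact sum_eq_zero fun τ _ => by simp [h]
    · obtain ⟨h1, h2, -⟩ := hb σ h
      rw [evL_apply K ω _ h2, sum_eq_single_of_mem (T σ) (hT σ h1)]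
      · rw [if_pos rfl, ← mul_assoc, hK.mul_self h2 (hsub σ h1) (hT σ h1) (hcard σ h1), one_mul]
      · intro τ _ hne
        rw [if_neg hne, mul_zero]

theorem evL_dL (hK : K.IsOrientedBy B n ω) {m : ℤ} {c : Pr → ℤ} (hc : c ∈ Tgr ℤ K m) :
    evL K B ω (dL ℤ K c) = bdRelL K B (evL K B ω c) := by
  rw [dL, LinearMap.add_apply, map_add, evL_dvL hK.cycle, add_zero,
    evL_dhL ω fun _ => Tgr.isFlag hc]

theorem exists_dL_eq_of_evL_eq_zero (hK : K.IsOrientedBy B n ω) {m : ℤ} {c : Pr → ℤ}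
    (hc : c ∈ Tgr ℤ K m) (hDc : dL ℤ K c = 0) (hev : evL K B ω c = 0) :
    ∃ x ∈ Tgr ℤ K (m - 1), evL K B ω x = 0 ∧ dL ℤ K x = c := by
  refine exists_of_filtration (dL ℤ K) (evL K B ω) (Tgr ℤ K m) (Tgr ℤ K (m - 1))
    (fun k c => ∀ x, c x ≠ 0 → x.1.card ≤ k) (dL_dL K)
    (fun x hx => by simpa using dL_mem_Tgr hx)
    (fun x hx h => by rw [hK.evL_dL hx, h, map_zero]) ?_ ?_ (n + 1) c hc ?_ hDc hev
  · intro c hc h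
    by_contra hne
    obtain ⟨x, hx⟩ := Function.ne_iff.1 hne
    exact (hc x hx).2.2.1 (card_eq_zero.1 (Nat.le_zero.1 (h x hx)))
  · intro k c hc hF hDc hev
    let c' : Pr → ℤ := fun x => if x.1.card = k + 1 then c x else 0
    have hc' : c' ∈ Ngr ℤ K k (k + m) := by
      intro x hx
      obtain ⟨h1, h2⟩ := ite_ne_right_iff.1 hx
      obtain ⟨h3, h4, h5, h6⟩ := hc x h2
      exact ⟨h3, h4, h5, by omega, by omega⟩
    have hzero : ∀ c : Pr → ℤ, (∀ x, c x ≠ 0 → x.1.card ≤ k + 1) →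
        ∀ σ τ, k < σ.card → dhL ℤ K c (σ, τ) = 0 := by
      intro c hF σ τ hσ
      by_contra h
      obtain ⟨-, v, hv, h'⟩ := exists_of_dhL_ne_zero h
      have h1 := hF _ h'
      simp only [card_insert_of_notMem (mem_sdiff.1 hv).2] at h1
      omega
    have hdc' : dvL ℤ K c' = 0 := by
      funext ⟨σ, τ⟩
      by_contra h
      obtain ⟨hf, w, hw, h'⟩ := exists_of_dvL_ne_zero h
      obtain ⟨h1, -⟩ := ite_ne_right_iff.1 h'
      have h2 := congrFun hDc (σ, τ)
      rw [dL_apply, hzero c hF σ τ (by simp only at h1; omega), zero_add, dvL_apply _ hf] at h2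
      apply h
      rw [dvL_apply _ hf, ← h2]
      simp only [c', h1, if_true]
    have hev' : evL K B ω c' = 0 := by
      funext σ
      by_cases hB : σ ∈ B.faces
      · exact evL_apply_of_mem K ω _ hB
      have h := congrFun hev σ
      rw [evL_apply K ω _ hB] at h ⊢
      by_cases h1 : σ.card = k + 1
      · simpa only [c', h1, if_true] using h
      · simp [c', h1]
    obtain ⟨x, hx, hevx, hdx⟩ := hK.exists_dvL_eq hc' hdc' hev'
    refine ⟨x, ?_, hevx, ?_⟩
    · have h := Ngr_le_Tgr K _ _ hx
      rwa [show (k : ℤ) + m - 1 - k = m - 1 by ring] at h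
    · rintro ⟨σ, τ⟩ h
      by_contra hk
      simp only [not_le] at hk
      apply h
      rw [Pi.sub_apply, dL_apply, hdx, hzero x _ σ τ hk, zero_add, sub_eq_zero]
      · by_cases h1 : σ.card = k + 1
        · exact (if_pos h1).symm
        · refine Eq.trans ?_ (if_neg h1).symm
          by_contra h2
          have h3 := hF _ h2
          simp only at h3
          omega
      · intro y hy
        have h1 := (hx y hy).2.2.2.1
        omega
  · intro x hx
    obtain ⟨h1, h2, -⟩ := hc x hx
    exact (card_le_card h1).trans (hK.card_le _ h2)

theorem nonempty_totH_equiv_Hrel (hK : K.IsOrientedBy B n ω) (m : ℤ) :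
    Nonempty (TotH ℤ K m ≃+ Hrel K B (n - m)) :=
  nonempty_cohomology_equiv (dL ℤ K) (bdRelL K B) (evL K B ω) (Tgr ℤ K)
    (fun m => RelC K B (n - m)) (dL_dL K) (fun _ _ => dL_mem_Tgr) (fun _ _ => hK.evL_mem)
    (fun _ _ => hK.evL_dL)
    (fun m b hb => by
      obtain ⟨c, hc, hcb⟩ := hK.exists_evL_eq hb
      exact ⟨c, by simpa using Ngr_le_Tgr K _ _ hc, hcb⟩)
    (fun _ _ => hK.exists_dL_eq_of_evL_eq_zero) m _
    fun b hb => by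
      rw [show (n : ℤ) - (m - 1) = n - m + 1 by ring]
      exact ⟨fun h => h.1, fun h => ⟨h, hb⟩⟩

theorem evL_mem_of_mem_Ngr (hK : K.IsOrientedBy B n ω) {p : ℤ} {c : Pr → ℤ}
    (hc : c ∈ Ngr ℤ K p n) : evL K B ω c ∈ RelC K B p := by
  simpa using hK.evL_mem (Ngr_le_Tgr K _ _ hc)

theorem dvL_eq_zero (hK : K.IsOrientedBy B n ω) {p : ℤ} {c : Pr → ℤ}
    (hc : c ∈ Ngr ℤ K p n) : dvL ℤ K c = 0 := by
  funext ⟨σ, τ⟩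
  by_contra h
  obtain ⟨hf, w, hw, h'⟩ := exists_of_dvL_ne_zero h
  have h1 := (hc _ h').2.2.2.2
  have h2 := card_erase_add_one (mem_sdiff.1 hw).1
  have h3 := hK.card_le τ hf.2.1
  simp only at h1
  omega

/-- Evaluation on the fundamental cycle, as a map from the `E₁`-cocycles to relative chains. -/
def evZ1 (hK : K.IsOrientedBy B n ω) (p : ℤ) : Z1 ℤ K p n →ₗ[ℤ] RelC K B p :=
  (evL K B ω).restrict fun _ hc => hK.evL_mem_of_mem_Ngr hc.1

theorem evZ1_surjective (hK : K.IsOrientedBy B n ω) (p : ℤ) :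
    Function.Surjective (hK.evZ1 p) := by
  rintro ⟨b, hb⟩
  obtain ⟨c, hc, rfl⟩ := hK.exists_evL_eq hb
  exact ⟨⟨c, hc, hK.dvL_eq_zero hc⟩, rfl⟩

theorem comap_B1_eq_ker (hK : K.IsOrientedBy B n ω) (p : ℤ) :
    (B1 ℤ K p n).comap (Z1 ℤ K p n).subtype = LinearMap.ker (hK.evZ1 p) := by
  ext ⟨c, hc⟩
  rw [LinearMap.mem_ker, Subtype.ext_iff]
  change c ∈ B1 ℤ K p n ↔ evL K B ω c = 0
  constructor
  · rintro ⟨⟨x, -, rfl⟩, -⟩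
    exact evL_dvL hK.cycle x
  · intro h
    obtain ⟨x, hx, -, hdx⟩ := hK.exists_dvL_eq hc.1 hc.2 h
    exact ⟨⟨x, hx, hdx⟩, hc.1⟩

/-- The isomorphism between row `n` of the `E₁`-page and the relative chains. -/
noncomputable def e1Equiv (hK : K.IsOrientedBy B n ω) (p : ℤ) : E1 ℤ K p n ≃+ RelC K B p :=
  ((Submodule.quotEquivOfEq _ _ (hK.comap_B1_eq_ker p)).trans
    (LinearMap.quotKerEquivOfSurjective _ (hK.evZ1_surjective p))).toAddEquiv

theorem e1Equiv_mk (hK : K.IsOrientedBy B n ω) (p : ℤ) (c : Pr → ℤ) (hc : c ∈ Z1 ℤ K p n) :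
    (hK.e1Equiv p (Submodule.Quotient.mk ⟨c, hc⟩) : Finset ℕ → ℤ) = evL K B ω c := rfl

end IsOrientedBy

end SC

/-- **Lefschetz duality.** If `K` triangulates a compact
`n`-manifold with boundary `B = ∂K` (expressed combinatorially: links of
interior simplices have the reduced cohomology of `S^{n-|σ|}`, links of
boundary simplices are acyclic, `K` is pure `n`-dimensional and orientable),
then the complex `(E₁^{*,n}(K), Δ₁)` is isomorphic to the relative chain
complex `(C_*(K, ∂K), d)`, and `H^{n-i}(K) ≅ H_i(K, ∂K)` for all `i`. -/
theorem lefschetz_duality (K B : SC) (n : ℕ) (hB : B.IsSub K)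
    (hdim : K.dim = (n : ℤ))
    (hpure : ∀ σ ∈ K.faces, ∃ τ ∈ K.faces, σ ⊆ τ ∧ τ.card = n + 1)
    (hint : ∀ σ ∈ K.faces, σ ≠ ∅ → σ ∉ B.faces →
      Nonempty (SC.cohR ℤ (K.link σ) ((n : ℤ) - σ.card) ≃+ ℤ) ∧
      ∀ i : ℤ, i ≠ (n : ℤ) - σ.card → Subsingleton (SC.cohR ℤ (K.link σ) i))
    (hbdry : ∀ σ ∈ K.faces, σ ≠ ∅ → σ ∈ B.faces →
      ∀ i : ℤ, Subsingleton (SC.cohR ℤ (K.link σ) i))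
    (horient : ∃ ω : Finset ℕ → ℤ, ω ∈ SC.RelC K B n ∧ SC.bdRelL K B ω = 0 ∧
      ∀ σ ∈ K.faces, σ.card = n + 1 → σ ∉ B.faces → ω σ = 1 ∨ ω σ = -1) :
    (∃ e : ∀ p : ℤ, SC.E1 ℤ K p n ≃+ ↥(SC.RelC K B p),
      ∀ (p : ℤ) (c : SC.Pr → ℤ) (hc : c ∈ SC.Z1 ℤ K p n)
        (hc' : SC.dhF ℤ K c ∈ SC.Z1 ℤ K (p - 1) n),
        ((e (p - 1) (Submodule.Quotient.mk ⟨SC.dhF ℤ K c, hc'⟩) : Finset ℕ → ℤ)) =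
          SC.bdRelF K B ((e p (Submodule.Quotient.mk ⟨c, hc⟩) : Finset ℕ → ℤ))) ∧
    ∀ i : ℤ, Nonempty (SC.coh ℤ K ((n : ℤ) - i) ≃+ SC.Hrel K B i) := by
  obtain ⟨ω, hω, hω0, hω1⟩ := horient
  have hK : K.IsOrientedBy B n ω :=
    { card_le := fun τ hτ => by
        have h1 := SC.card_le_sup hτ
        rw [SC.dim] at hdim
        omega
      pure := hpure
      interior := hint
      boundary := hbdry
      mem_RelC := hω
      cycle := hω0
      unit := hω1 }
  refine ⟨⟨hK.e1Equiv, fun p c hc hc' => ?_⟩, fun i => ?_⟩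
  · rw [hK.e1Equiv_mk, hK.e1Equiv_mk]
    refine SC.evL_dhL ω fun x hx => ?_
    have h := hc.1 x hx
    exact ⟨h.1, h.2.1, h.2.2.1⟩
  · obtain ⟨e⟩ := SC.nonempty_totH_equiv_coh K (n - i)
    have h := hK.nonempty_totH_equiv_Hrel (n - i)
    rw [sub_sub_cancel] at h
    obtain ⟨e'⟩ := h
    exact ⟨e.symm.trans e'⟩
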